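/- arXiv:2104.01886 — 2 statements merged into one kernel-verified Lean document; each statement's English description precedes it below -/
import Mathlib

section
/- Let κ > 0 with κ ∉ ℕ. Then for every ε > 0 there exists H₀ such that for all integers H ≥ H₀ and all real y with |y| ≤ 1/2: | Σ_{H/2 ≤ ℓ < H} e^{2πi·y·⌊ℓ^κ⌋} | ≤ | Σ_{H/2 ≤ ℓ < H} e^{2πi·y·ℓ^κ} | + πH/8 + εH, where the sums run over integers ℓ with H/2 ≤ ℓ < H. -/
open Filter Topology Real

/-- The Piatetski-Shapiro part: `⌊ℓ^κ⌋`. -/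
noncomputable def psPart (κ : ℝ) (ℓ : ℕ) : ℕ := ⌊(ℓ : ℝ) ^ κ⌋₊

/-- The average of the first `N` terms of a complex sequence. -/
noncomputable def cesaroMean (u : ℕ → ℂ) (N : ℕ) : ℂ := (N : ℝ)⁻¹ • ∑ n ∈ Finset.range N, u n

theorem norm_cesaroMean_le {u : ℕ → ℂ} {C : ℝ} (hC : 0 ≤ C) (hu : ∀ n, ‖u n‖ ≤ C) (N : ℕ) :
    ‖cesaroMean u N‖ ≤ C := by
  rcases Nat.eq_zero_or_pos N with rfl | hN
  · simpa [cesaroMean] using hC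
  · have hN' : (0 : ℝ) < N := by exact_mod_cast hN
    rw [cesaroMean, norm_smul, norm_inv, Real.norm_natCast, inv_mul_le_iff₀ hN']
    exact (norm_sum_le_of_le _ fun n _ => hu n).trans (by simp)

theorem tendsto_const_div_natCast (C : ℝ) : Tendsto (fun N : ℕ => C / (N : ℝ)) atTop (𝓝 0) :=
  tendsto_const_nhds.div_atTop tendsto_natCast_atTop_atTop

theorem norm_cesaroMean_shift_sub_le {u : ℕ → ℂ} (hu : ∀ n, ‖u n‖ ≤ 1) (j N : ℕ) :
    ‖cesaroMean (fun n => u (n + j)) N - cesaroMean u N‖ ≤ 2 * j / (N : ℝ) := by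
  have h : ∑ n ∈ Finset.range N, u (n + j) - ∑ n ∈ Finset.range N, u n =
      ∑ n ∈ Finset.range j, u (N + n) - ∑ n ∈ Finset.range j, u n := by
    have h1 := Finset.sum_range_add u N j
    have h2 := Finset.sum_range_add u j N
    rw [add_comm j N, h1] at h2
    simp only [add_comm j] at h2
    linear_combination -h2
  rw [cesaroMean, cesaroMean, ← smul_sub, h, norm_smul, norm_inv, Real.norm_natCast, div_eq_inv_mul]
  gcongr
  have h3 : ‖∑ n ∈ Finset.range j, u (N + n)‖ ≤ j :=
    (norm_sum_le_of_le _ fun n _ => hu _).trans (by simp)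
  have h4 : ‖∑ n ∈ Finset.range j, u n‖ ≤ j :=
    (norm_sum_le_of_le _ fun n _ => hu _).trans (by simp)
  linarith [norm_sub_le (∑ n ∈ Finset.range j, u (N + n)) (∑ n ∈ Finset.range j, u n)]

theorem tendsto_cesaroMean_shift {u : ℕ → ℂ} (hu : ∀ n, ‖u n‖ ≤ 1) (j : ℕ) :
    Tendsto (cesaroMean fun n => u (n + j)) atTop (𝓝 0) ↔ Tendsto (cesaroMean u) atTop (𝓝 0) := by
  have h : Tendsto (fun N => cesaroMean (fun n => u (n + j)) N - cesaroMean u N) atTop (𝓝 0) :=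
    squeeze_zero_norm (norm_cesaroMean_shift_sub_le hu j) (tendsto_const_div_natCast _)
  constructor
  · intro h'
    simpa using h'.sub h
  · intro h'
    simpa using h.add h'

/-- The qualitative van der Corput inequality. -/
theorem tendsto_cesaroMean_of_correlations {z : ℕ → ℂ} (hz : ∀ n, ‖z n‖ ≤ 1)
    (h : ∀ k : ℕ, 0 < k → Tendsto (cesaroMean fun n => z (n + k) * star (z n)) atTop (𝓝 0)) :
    Tendsto (cesaroMean z) atTop (𝓝 0) := by
  have hprod : ∀ m n, ‖z m * star (z n)‖ ≤ 1 := fun m n => by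
    rw [norm_mul, norm_star]
    exact mul_le_one₀ (hz m) (norm_nonneg _) (hz n)
  have hoff : ∀ i j : ℕ, i ≠ j →
      Tendsto (cesaroMean fun n => z (n + i) * star (z (n + j))) atTop (𝓝 0) := by
    intro i j hij
    rcases lt_or_gt_of_ne hij with hlt | hlt
    · obtain ⟨k, hk, rfl⟩ : ∃ k, 0 < k ∧ j = k + i := ⟨j - i, by omega, by omega⟩
      have h1 := ((tendsto_cesaroMean_shift (fun n => hprod (n + k) n) i).2 (h k hk)).star
      rw [star_zero] at h1
      refine h1.congr fun N => ?_
      simp only [cesaroMean, star_smul, star_sum, star_mul, star_star, star_trivial]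
      congr 1
      refine Finset.sum_congr rfl fun n _ => ?_
      rw [show n + i + k = n + (k + i) by ring]
    · obtain ⟨k, hk, rfl⟩ : ∃ k, 0 < k ∧ i = k + j := ⟨i - j, by omega, by omega⟩
      have h1 := (tendsto_cesaroMean_shift (fun n => hprod (n + k) n) j).2 (h k hk)
      refine h1.congr fun N => ?_
      simp only [cesaroMean]
      congr 1
      refine Finset.sum_congr rfl fun n _ => ?_
      rw [show n + j + k = n + (k + j) by ring]
  -- the bound for windows of length `M`
  have key : ∀ M : ℕ, 0 < M → ∀ᶠ N in atTop, ‖cesaroMean z N‖ ≤ Real.sqrt (2 / M) + 1 / M := by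
    intro M hM
    have hM' : (0 : ℝ) < M := by exact_mod_cast hM
    let w : ℕ → ℂ := fun n => ∑ j ∈ Finset.range M, z (n + j)
    have hw1 : ∀ N, ‖cesaroMean w N - M * cesaroMean z N‖ ≤
        ∑ j ∈ Finset.range M, 2 * j / (N : ℝ) := by
      intro N
      have : cesaroMean w N - M * cesaroMean z N =
          ∑ j ∈ Finset.range M, (cesaroMean (fun n => z (n + j)) N - cesaroMean z N) := by
        rw [Finset.sum_sub_distrib]
        simp only [w, cesaroMean, Finset.sum_const, Finset.card_range, nsmul_eq_mul]
        rw [← Finset.smul_sum, Finset.sum_comm]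
      rw [this]
      exact norm_sum_le_of_le _ fun j _ => norm_cesaroMean_shift_sub_le hz j N
    have hw1' : ∀ᶠ N : ℕ in atTop, ∑ j ∈ Finset.range M, 2 * j / (N : ℝ) < 1 := by
      have : Tendsto (fun N : ℕ => ∑ j ∈ Finset.range M, 2 * j / (N : ℝ)) atTop (𝓝 0) := by
        simpa using tendsto_finsetSum (Finset.range M) fun j _ =>
          tendsto_const_div_natCast (2 * j)
      exact this.eventually_lt_const one_pos
    have hw2 : ∀ N : ℕ, ‖cesaroMean w N‖ ^ 2 ≤ ‖cesaroMean (fun n => w n * star (w n)) N‖ := by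
      intro N
      rcases Nat.eq_zero_or_pos N with rfl | hN
      · simp [cesaroMean]
      have hN' : (0 : ℝ) < N := by exact_mod_cast hN
      have e : ∑ n ∈ Finset.range N, w n * star (w n) =
          ((∑ n ∈ Finset.range N, ‖w n‖ ^ 2 : ℝ) : ℂ) := by
        push_cast
        exact Finset.sum_congr rfl fun n _ => by
          rw [Complex.star_def, Complex.mul_conj, Complex.normSq_eq_norm_sq]; push_cast; rfl
      have hnn : 0 ≤ ∑ n ∈ Finset.range N, ‖w n‖ ^ 2 := Finset.sum_nonneg fun _ _ => by positivity
      rw [cesaroMean, cesaroMean, e, norm_smul, norm_smul, norm_inv, Real.norm_natCast,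
        Complex.norm_real, Real.norm_of_nonneg hnn]
      have h1 : ‖∑ n ∈ Finset.range N, w n‖ ^ 2 ≤ N * ∑ n ∈ Finset.range N, ‖w n‖ ^ 2 := by
        calc _ ≤ (∑ n ∈ Finset.range N, ‖w n‖) ^ 2 := by gcongr; exact norm_sum_le _ _
          _ ≤ _ := by simpa using sq_sum_le_card_mul_sum_sq (s := Finset.range N) (f := fun n => ‖w n‖)
      rw [mul_pow]
      calc _ ≤ (N : ℝ)⁻¹ ^ 2 * (N * ∑ n ∈ Finset.range N, ‖w n‖ ^ 2) := by gcongr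
        _ = _ := by field_simp
    have hw3 : ∀ N, cesaroMean (fun n => w n * star (w n)) N =
        ∑ i ∈ Finset.range M, ∑ j ∈ Finset.range M,
          cesaroMean (fun n => z (n + i) * star (z (n + j))) N := by
      intro N
      simp only [w, cesaroMean, star_sum, Finset.sum_mul_sum, ← Finset.smul_sum]
      rw [Finset.sum_comm]
      congr 1
      exact Finset.sum_congr rfl fun i _ => Finset.sum_comm
    have hw4 : ∀ N, ‖cesaroMean (fun n => w n * star (w n)) N‖ ≤
        M + ∑ i ∈ Finset.range M, ∑ j ∈ Finset.range M,
          (if i = j then 0 else ‖cesaroMean (fun n => z (n + i) * star (z (n + j))) N‖) := by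
      intro N
      rw [hw3]
      have : (M : ℝ) = ∑ i ∈ Finset.range M, ∑ j ∈ Finset.range M, if i = j then (1 : ℝ) else 0 := by
        rw [Finset.sum_congr rfl fun i hi => by rw [Finset.sum_ite_eq, if_pos hi]]
        simp
      rw [this, ← Finset.sum_add_distrib]
      refine norm_sum_le_of_le _ fun i _ => ?_
      rw [← Finset.sum_add_distrib]
      refine norm_sum_le_of_le _ fun j _ => ?_
      split_ifs
      · rw [add_zero]
        exact norm_cesaroMean_le zero_le_one (fun n => hprod _ _) N
      · rw [zero_add]
    have hw5 : ∀ᶠ N in atTop, ∑ i ∈ Finset.range M, ∑ j ∈ Finset.range M,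
        (if i = j then 0 else ‖cesaroMean (fun n => z (n + i) * star (z (n + j))) N‖) < M := by
      have : Tendsto (fun N => ∑ i ∈ Finset.range M, ∑ j ∈ Finset.range M,
          (if i = j then 0 else ‖cesaroMean (fun n => z (n + i) * star (z (n + j))) N‖))
          atTop (𝓝 (∑ i ∈ Finset.range M, ∑ j ∈ Finset.range M, 0)) := by
        refine tendsto_finsetSum _ fun i _ => tendsto_finsetSum _ fun j _ => ?_
        by_cases hij : i = j
        · simp [hij]
        · simpa [hij] using (hoff i j hij).norm
      simp only [Finset.sum_const_zero] at this
      exact this.eventually_lt_const hM'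
    filter_upwards [hw1', hw5] with N h1 h5
    have h6 : ‖cesaroMean w N‖ ≤ Real.sqrt (2 * M) :=
      Real.le_sqrt_of_sq_le (by linarith [hw2 N, hw4 N])
    have h7 : M * ‖cesaroMean z N‖ ≤ Real.sqrt (2 * M) + 1 := by
      have : ‖(M : ℂ) * cesaroMean z N‖ = M * ‖cesaroMean z N‖ := by simp
      rw [← this]
      have := norm_sub_norm_le ((M : ℂ) * cesaroMean z N) (cesaroMean w N)
      rw [norm_sub_rev] at this
      linarith [hw1 N]
    have h8 : Real.sqrt (2 * M) = M * Real.sqrt (2 / M) := by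
      rw [show (2 : ℝ) * M = M ^ 2 * (2 / M) by field_simp, Real.sqrt_mul (by positivity),
        Real.sqrt_sq hM'.le]
    rw [h8] at h7
    refine le_of_mul_le_mul_left ?_ hM'
    calc _ ≤ _ := h7
      _ = _ := by field_simp
  rw [Metric.tendsto_atTop']
  intro ε hε
  have hlim : Tendsto (fun M : ℕ => Real.sqrt (2 / M) + 1 / M) atTop (𝓝 0) := by
    simpa using (Real.continuous_sqrt.tendsto 0).comp (tendsto_const_div_natCast 2) |>.add
      (by simpa using tendsto_const_div_natCast 1)
  obtain ⟨M, hM1, hM⟩ := ((hlim.eventually_lt_const hε).and (eventually_gt_atTop 0)).exists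
  obtain ⟨N₀, hN₀⟩ := eventually_atTop.1 (key M hM)
  exact ⟨N₀, fun N hN => by simpa using (hN₀ N hN.le).trans_lt hM1⟩

/-- The unit complex number with argument `x`. -/
noncomputable def unitExp (x : ℝ) : ℂ := Complex.exp (x * Complex.I)

theorem norm_unitExp (x : ℝ) : ‖unitExp x‖ = 1 := Complex.norm_exp_ofReal_mul_I x

theorem unitExp_add (x y : ℝ) : unitExp (x + y) = unitExp x * unitExp y := by
  simp only [unitExp, ← Complex.exp_add]
  push_cast
  ring_nf

theorem star_unitExp (x : ℝ) : star (unitExp x) = unitExp (-x) := by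
  simp [unitExp, ← Complex.exp_conj]

theorem norm_sum_sub_mul_le {z : ℕ → ℂ} {g : ℕ → ℝ} (hz : ∀ n, ‖z n‖ ≤ 1) (hg : Monotone g)
    (hg0 : 0 ≤ g 0) (N : ℕ) :
    ‖∑ n ∈ Finset.range N, (z (n + 1) - z n) * g n‖ ≤ 2 * g N := by
  have h : ∑ n ∈ Finset.range N, (z (n + 1) - z n) * g n =
      z N * g N - z 0 * g 0 - ∑ n ∈ Finset.range N, z (n + 1) * ((g (n + 1) - g n : ℝ) : ℂ) := by
    induction N with
    | zero => simp
    | succ N ih =>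
      rw [Finset.sum_range_succ, Finset.sum_range_succ, ih]
      push_cast
      ring
  have hmul : ∀ n {t : ℝ}, 0 ≤ t → ‖z n * t‖ ≤ t := fun n t ht => by
    rw [norm_mul, Complex.norm_of_nonneg ht]
    exact mul_le_of_le_one_left ht (hz n)
  have h1 : ‖∑ n ∈ Finset.range N, z (n + 1) * ((g (n + 1) - g n : ℝ) : ℂ)‖ ≤ g N - g 0 := by
    rw [← Finset.sum_range_sub]
    exact norm_sum_le_of_le _ fun n _ => hmul _ (sub_nonneg.2 (hg n.le_succ))
  rw [h]
  have h2 := norm_sub_le (z N * g N - z 0 * g 0)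
    (∑ n ∈ Finset.range N, z (n + 1) * ((g (n + 1) - g n : ℝ) : ℂ))
  have h3 := norm_sub_le (z N * g N) (z 0 * g 0)
  linarith [hmul N (hg0.trans (hg N.zero_le)), hmul 0 hg0]

/-- A positive sequence decreases to zero more slowly than `1 / n`. -/
structure SlowDecay (d : ℕ → ℝ) : Prop where
  pos : ∀ n, 0 < d n
  antitone : Antitone d
  tendsto_zero : Tendsto d atTop (𝓝 0)
  tendsto_mul : Tendsto (fun n : ℕ => n * d n) atTop atTop

theorem SlowDecay.sum_shift {d : ℕ → ℝ} (hd : SlowDecay d) {h : ℕ} (hh : 0 < h) :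
    SlowDecay fun n => ∑ j ∈ Finset.range h, d (n + j) where
  pos n := Finset.sum_pos (fun _ _ => hd.pos _) (Finset.nonempty_range_iff.2 hh.ne')
  antitone m n hmn := Finset.sum_le_sum fun _ _ => hd.antitone (by omega)
  tendsto_zero := by
    simpa using tendsto_finsetSum (Finset.range h) fun j _ =>
      hd.tendsto_zero.comp (tendsto_add_atTop_nat j)
  tendsto_mul := by
    refine tendsto_atTop_mono (fun n => ?_) hd.tendsto_mul
    gcongr
    exact Finset.single_le_sum (f := fun j => d (n + j)) (fun _ _ => (hd.pos _).le)
      (Finset.mem_range.2 hh)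

/-- Fejér's criterion. -/
theorem tendsto_cesaroMean_of_slowDecay_diff {x : ℕ → ℝ} (hx : SlowDecay (fwdDiff 1 x)) :
    Tendsto (cesaroMean fun n => unitExp (x n)) atTop (𝓝 0) := by
  set d := fwdDiff 1 x with hd
  let z : ℕ → ℂ := fun n => unitExp (x n)
  let q : ℝ → ℂ := fun t => 1 - (t⁻¹ : ℝ) • (unitExp t - 1) / Complex.I
  have hq : Tendsto q (𝓝[≠] 0) (𝓝 0) := by
    have h1 : HasDerivAt unitExp Complex.I 0 := by
      have := ((hasDerivAt_id (0 : ℝ)).ofReal_comp.mul_const Complex.I).cexp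
      simp only [id, Complex.ofReal_zero, zero_mul, Complex.exp_zero, Complex.ofReal_one, one_mul] at this
      exact this
    have h2 := hasDerivAt_iff_tendsto_slope_zero.1 h1
    have h3 := (h2.div_const Complex.I).const_sub 1
    simpa [q, unitExp] using h3
  have hr : Tendsto (fun n => z n * q (d n)) atTop (𝓝 0) := by
    have h1 : Tendsto (fun n => q (d n)) atTop (𝓝 0) :=
      hq.comp (tendsto_nhdsWithin_iff.2
        ⟨hx.tendsto_zero, Eventually.of_forall fun n => (hx.pos n).ne'⟩)
    refine squeeze_zero_norm (fun n => ?_) (tendsto_zero_iff_norm_tendsto_zero.1 h1)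
    rw [norm_mul, norm_unitExp, one_mul]
  have hsplit : ∀ n, z n = z n * q (d n) + (z (n + 1) - z n) * ((d n)⁻¹ : ℝ) * Complex.I⁻¹ := by
    intro n
    have : z (n + 1) = z n * unitExp (d n) := by
      simp only [z, ← unitExp_add, hd, fwdDiff]
      congr 1
      ring
    rw [this]
    simp only [q, Complex.real_smul]
    field_simp
    ring
  have hmono : Monotone fun n => (d n)⁻¹ := fun m n hmn =>
    inv_anti₀ (hx.pos n) (hx.antitone hmn)
  have hmain : Tendsto (cesaroMean fun n => (z (n + 1) - z n) * ((d n)⁻¹ : ℝ) * Complex.I⁻¹)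
      atTop (𝓝 0) := by
    have h1 : Tendsto (fun N : ℕ => 2 * ((N : ℝ) * d N)⁻¹) atTop (𝓝 0) := by
      simpa using hx.tendsto_mul.inv_tendsto_atTop.const_mul 2
    refine squeeze_zero_norm (fun N => ?_) h1
    rw [cesaroMean, ← Finset.sum_mul, norm_smul, norm_mul, norm_inv, Real.norm_natCast, norm_inv,
      Complex.norm_I, inv_one, mul_one, mul_inv, mul_left_comm]
    gcongr
    exact norm_sum_sub_mul_le (fun n => (norm_unitExp _).le) hmono (inv_pos.2 (hx.pos 0)).le N
  have := hr.cesaro_smul.add hmain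
  rw [add_zero] at this
  refine this.congr fun N => ?_
  rw [cesaroMean, cesaroMean, ← smul_add, ← Finset.sum_add_distrib]
  congr 1
  exact Finset.sum_congr rfl fun n _ => (hsplit n).symm

theorem fwdDiff_iterate_shift_sub (x : ℕ → ℝ) (h k : ℕ) :
    (fwdDiff 1)^[k] (fun n => x (n + h) - x n) =
      fun n => (fwdDiff 1)^[k] x (n + h) - (fwdDiff 1)^[k] x n := by
  induction k generalizing x with
  | zero => rfl
  | succ k ih =>
    simp only [Function.iterate_succ_apply]
    rw [← ih]
    congr 1
    funext n
    simp only [fwdDiff]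
    rw [add_right_comm]
    ring

theorem tendsto_cesaroMean_of_slowDecay_iterate_diff (k : ℕ) {x : ℕ → ℝ}
    (hx : SlowDecay ((fwdDiff 1)^[k + 1] x)) :
    Tendsto (cesaroMean fun n => unitExp (x n)) atTop (𝓝 0) := by
  induction k generalizing x with
  | zero => exact tendsto_cesaroMean_of_slowDecay_diff hx
  | succ k ih =>
    refine tendsto_cesaroMean_of_correlations (fun n => (norm_unitExp _).le) fun h hh => ?_
    have : SlowDecay ((fwdDiff 1)^[k + 1] fun n => x (n + h) - x n) := by
      convert hx.sum_shift hh using 1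
      rw [fwdDiff_iterate_shift_sub]
      funext n
      rw [Function.iterate_succ_apply' _ (k + 1)]
      exact (Finset.sum_range_sub (fun j => (fwdDiff 1)^[k + 1] x (n + j)) h).symm
    refine (ih this).congr fun N => ?_
    simp only [star_unitExp, ← unitExp_add, sub_eq_add_neg]

/-- The continuous analogue of `SlowDecay` on the positive half-line. -/
structure SlowDecayOn (d : ℝ → ℝ) : Prop where
  pos : ∀ x, 0 < x → 0 < d x
  antitone : AntitoneOn d (Set.Ioi 0)
  tendsto_zero : Tendsto d atTop (𝓝 0)
  tendsto_mul : Tendsto (fun x => x * d x) atTop atTop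

theorem SlowDecayOn.const_mul {d : ℝ → ℝ} (hd : SlowDecayOn d) {c : ℝ} (hc : 0 < c) :
    SlowDecayOn fun x => c * d x where
  pos x hx := mul_pos hc (hd.pos x hx)
  antitone _ hx _ hy hxy := mul_le_mul_of_nonneg_left (hd.antitone hx hy hxy) hc.le
  tendsto_zero := by simpa using hd.tendsto_zero.const_mul c
  tendsto_mul := (hd.tendsto_mul.const_mul_atTop hc).congr fun x => by ring

theorem SlowDecayOn.fwdDiff_of_hasDerivAt {F G : ℝ → ℝ} (hG : SlowDecayOn G)
    (hF : ∀ x, 0 < x → HasDerivAt F (G x) x) : SlowDecayOn (fwdDiff 1 F) := by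
  have hmvt : ∀ x, 0 < x → G (x + 1) ≤ F (x + 1) - F x ∧ F (x + 1) - F x ≤ G x := by
    intro x hx
    obtain ⟨c, hc, hc'⟩ := exists_hasDerivAt_eq_slope F G (lt_add_one x)
      (fun t ht => (hF t (hx.trans_le ht.1)).continuousAt.continuousWithinAt)
      (fun t ht => hF t (hx.trans ht.1))
    rw [add_sub_cancel_left, div_one] at hc'
    rw [← hc']
    have hc0 : 0 < c := hx.trans hc.1
    exact ⟨hG.antitone hc0 (by simp only [Set.mem_Ioi]; linarith) hc.2.le,
      hG.antitone hx hc0 hc.1.le⟩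
  have hlim : Tendsto (fun x => G (x + 1)) atTop (𝓝 0) :=
    hG.tendsto_zero.comp (tendsto_atTop_add_const_right _ 1 tendsto_id)
  have hder : ∀ x, 0 < x → HasDerivAt (fwdDiff 1 F) (G (x + 1) - G x) x := fun x hx =>
    ((hF (x + 1) (by linarith)).comp_add_const x 1).sub (hF x hx)
  refine ⟨fun x hx => (hG.pos _ (by linarith)).trans_le (hmvt x hx).1, ?_, ?_, ?_⟩
  · refine antitoneOn_of_deriv_nonpos (convex_Ioi 0)
      (fun x hx => (hder x hx).continuousAt.continuousWithinAt) ?_ ?_ <;> rw [interior_Ioi]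
    · exact fun x hx => (hder x hx).differentiableAt.differentiableWithinAt
    · intro x hx
      rw [(hder x hx).deriv]
      have hx' : (0 : ℝ) < x := hx
      exact sub_nonpos.2 (hG.antitone hx (by simp only [Set.mem_Ioi]; linarith) (by linarith))
  · refine tendsto_of_tendsto_of_tendsto_of_le_of_le' hlim hG.tendsto_zero ?_ ?_ <;>
      filter_upwards [eventually_gt_atTop 0] with x hx
    exacts [(hmvt x hx).1, (hmvt x hx).2]
  · have h1 : Tendsto (fun x => (x + 1) * G (x + 1) + -G (x + 1)) atTop atTop :=
      (hG.tendsto_mul.comp (tendsto_atTop_add_const_right _ 1 tendsto_id)).atTop_add hlim.neg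
    refine tendsto_atTop_mono' _ ?_ h1
    filter_upwards [eventually_gt_atTop 0] with x hx
    have := mul_le_mul_of_nonneg_left (hmvt x hx).1 hx.le
    simp only [fwdDiff]
    linarith

theorem HasDerivAt.fwdDiff_iterate {f f' : ℝ → ℝ} (k : ℕ)
    (hf : ∀ x, 0 < x → HasDerivAt f (f' x) x) :
    ∀ x, 0 < x → HasDerivAt ((fwdDiff 1)^[k] f) ((fwdDiff 1)^[k] f' x) x := by
  induction k generalizing f f' with
  | zero => exact hf
  | succ k ih =>
    simp only [Function.iterate_succ_apply]
    exact ih fun x hx => ((hf (x + 1) (by linarith)).comp_add_const x 1).sub (hf x hx)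

theorem slowDecayOn_fwdDiff_iterate_rpow (k : ℕ) {κ : ℝ} (h1 : (k : ℝ) - 1 < κ) (h2 : κ < k) :
    SlowDecayOn ((fwdDiff 1)^[k] fun x : ℝ => x ^ κ) := by
  induction k generalizing κ with
  | zero =>
    rw [Nat.cast_zero] at h1 h2
    refine ⟨fun x hx => rpow_pos_of_pos hx κ,
      fun x hx y _ hxy => rpow_le_rpow_of_nonpos hx hxy h2.le, ?_, ?_⟩
    · simpa using tendsto_rpow_neg_atTop (neg_pos.2 h2)
    · refine (tendsto_rpow_atTop (y := 1 + κ) (by linarith)).congr' ?_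
      filter_upwards [eventually_gt_atTop 0] with x hx
      simp [rpow_add hx]
  | succ k ih =>
    push_cast at h1 h2
    have hκ : 0 < κ := by
      have := k.cast_nonneg (α := ℝ)
      linarith
    rw [Function.iterate_succ_apply']
    refine ((ih (κ := κ - 1) (by linarith) (by linarith)).const_mul hκ).fwdDiff_of_hasDerivAt ?_
    intro x hx
    have := HasDerivAt.fwdDiff_iterate (f := fun x : ℝ => x ^ κ)
      (f' := κ • fun x : ℝ => x ^ (κ - 1)) k
      (fun x hx => by simpa using hasDerivAt_rpow_const (Or.inl hx.ne')) x hx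
    rwa [fwdDiff_iter_const_smul] at this

theorem fwdDiff_iterate_comp_natCast_add_one (f : ℝ → ℝ) (k : ℕ) :
    (fwdDiff 1)^[k] (fun n : ℕ => f (n + 1)) = fun n : ℕ => (fwdDiff 1)^[k] f (n + 1) := by
  induction k generalizing f with
  | zero => rfl
  | succ k ih =>
    simp only [Function.iterate_succ_apply]
    rw [← ih]
    congr 1
    funext n
    simp [fwdDiff]

theorem SlowDecayOn.slowDecay {d : ℝ → ℝ} (hd : SlowDecayOn d) :
    SlowDecay fun n : ℕ => d (n + 1) := by
  have hcast : Tendsto (fun n : ℕ => (n : ℝ) + 1) atTop atTop :=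
    tendsto_atTop_add_const_right _ 1 tendsto_natCast_atTop_atTop
  have h0 := hd.tendsto_zero.comp hcast
  refine ⟨fun n => hd.pos _ (by positivity), fun m n hmn => ?_, h0, ?_⟩
  · exact hd.antitone (Set.mem_Ioi.2 (by positivity)) (Set.mem_Ioi.2 (by positivity)) (by gcongr)
  · refine ((hd.tendsto_mul.comp hcast).atTop_add h0.neg).congr fun n => ?_
    simp only [Function.comp_apply]
    ring

theorem tendsto_cesaroMean_unitExp_rpow {κ : ℝ} (hκ : 0 < κ) (hκn : ∀ j : ℕ, κ ≠ j) {α : ℝ}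
    (hα : α ≠ 0) : Tendsto (cesaroMean fun n => unitExp (α * (n : ℝ) ^ κ)) atTop (𝓝 0) := by
  wlog hpos : 0 < α generalizing α
  · have h := (this (neg_ne_zero.2 hα) (by
      rcases lt_or_gt_of_ne hα with h | h
      exacts [neg_pos.2 h, absurd h hpos])).star
    rw [star_zero] at h
    refine h.congr fun N => ?_
    simp [cesaroMean, star_unitExp, -RCLike.star_def]
  rw [← tendsto_cesaroMean_shift (fun n => (norm_unitExp _).le) 1]
  have hfl : (⌊κ⌋₊ : ℝ) < κ := lt_of_le_of_ne (Nat.floor_le hκ.le) (hκn _).symm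
  have h := ((slowDecayOn_fwdDiff_iterate_rpow (⌊κ⌋₊ + 1) (κ := κ) (by push_cast; linarith)
    (by push_cast; exact Nat.lt_floor_add_one κ)).const_mul hpos).slowDecay
  have e : (fwdDiff 1)^[⌊κ⌋₊ + 1] (fun n : ℕ => α * ((n : ℝ) + 1) ^ κ) =
      fun n : ℕ => α * (fwdDiff 1)^[⌊κ⌋₊ + 1] (fun x : ℝ => x ^ κ) (n + 1) := by
    rw [fwdDiff_iterate_comp_natCast_add_one fun x => α * x ^ κ]
    funext n
    have := fwdDiff_iter_const_smul (1 : ℝ) α (fun x : ℝ => x ^ κ) (⌊κ⌋₊ + 1)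
    exact congrFun this _
  rw [← e] at h
  simpa using tendsto_cesaroMean_of_slowDecay_iterate_diff _ h

/-- Weyl's criterion: vanishing exponential means imply equidistribution. -/
theorem tendsto_cesaroMean_of_fourier {x : ℕ → UnitAddCircle}
    (h : ∀ k : ℤ, k ≠ 0 → Tendsto (cesaroMean fun n => fourier k (x n)) atTop (𝓝 0))
    (f : C(UnitAddCircle, ℂ)) :
    Tendsto (cesaroMean fun n => f (x n)) atTop
      (𝓝 (∫ t, f t ∂AddCircle.haarAddCircle)) := by
  let S : Submodule ℂ C(UnitAddCircle, ℂ) :=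
    { carrier := {f | Tendsto (cesaroMean fun n => f (x n)) atTop
        (𝓝 (∫ t, f t ∂AddCircle.haarAddCircle))}
      zero_mem' := by
        have e : (cesaroMean fun _ => 0) = fun _ => 0 := by
          funext N
          simp [cesaroMean]
        simp [e]
      add_mem' := by
        intro f g hf hg
        have e : ∫ t, (f + g) t ∂AddCircle.haarAddCircle =
            (∫ t, f t ∂AddCircle.haarAddCircle) + ∫ t, g t ∂AddCircle.haarAddCircle :=
          MeasureTheory.integral_add
            (f.continuous.integrable_of_hasCompactSupport (HasCompactSupport.of_compactSpace _))
            (g.continuous.integrable_of_hasCompactSupport (HasCompactSupport.of_compactSpace _))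
        rw [Set.mem_ofPred_eq, e]
        refine (Tendsto.add hf hg).congr fun N => ?_
        simp [cesaroMean, Finset.sum_add_distrib]
      smul_mem' := by
        intro c f hf
        have e : ∫ t, (c • f) t ∂AddCircle.haarAddCircle =
            c • ∫ t, f t ∂AddCircle.haarAddCircle := MeasureTheory.integral_smul c f
        rw [Set.mem_ofPred_eq, e]
        refine (Tendsto.const_smul hf c).congr fun N => ?_
        simp [cesaroMean, ← Finset.mul_sum, mul_left_comm] }
  have hspan : Submodule.span ℂ (Set.range (@fourier 1)) ≤ S := by
    rw [Submodule.span_le]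
    rintro _ ⟨k, rfl⟩
    change Tendsto _ _ _
    by_cases hk : k = 0
    · subst hk
      simp only [fourier_zero, MeasureTheory.integral_const, MeasureTheory.probReal_univ, one_smul]
      refine tendsto_const_nhds.congr' ?_
      filter_upwards [eventually_gt_atTop 0] with N hN
      have : (N : ℂ) ≠ 0 := by exact_mod_cast hN.ne'
      simp [cesaroMean, this]
    · have e := congrFun (fourierCoeff_fourier (T := 1) k) 0
      rw [Pi.single_eq_of_ne (Ne.symm hk)] at e
      have e' : ∫ t, fourier k t ∂(AddCircle.haarAddCircle (T := (1 : ℝ))) = 0 := by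
        simpa [fourierCoeff] using e
      rw [e']
      exact h k hk
  have hf : f ∈ (Submodule.span ℂ (Set.range (@fourier 1))).topologicalClosure := by
    rw [span_fourier_closure_eq_top]
    trivial
  rw [Metric.tendsto_atTop]
  intro ε hε
  obtain ⟨g, hg, hgf⟩ := Metric.mem_closure_iff.1 hf (ε / 3) (by positivity)
  obtain ⟨N₀, hN₀⟩ := Metric.tendsto_atTop.1 (hspan hg) (ε / 3) (by positivity)
  refine ⟨N₀, fun N hN => ?_⟩
  have hfg : ∀ t, ‖f t - g t‖ ≤ ε / 3 := fun t => by
    rw [← dist_eq_norm]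
    exact (ContinuousMap.dist_apply_le_dist t).trans hgf.le
  have h1 : dist (cesaroMean (fun n => f (x n)) N) (cesaroMean (fun n => g (x n)) N) ≤ ε / 3 := by
    have := norm_cesaroMean_le (by positivity) (fun n => hfg (x n)) N
    rwa [cesaroMean, Finset.sum_sub_distrib, smul_sub, ← dist_eq_norm] at this
  have h2 : dist (∫ t, g t ∂AddCircle.haarAddCircle) (∫ t, f t ∂AddCircle.haarAddCircle)
      ≤ ε / 3 := by
    rw [dist_comm, dist_eq_norm, ← MeasureTheory.integral_sub
      (f.continuous.integrable_of_hasCompactSupport (HasCompactSupport.of_compactSpace _))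
      (g.continuous.integrable_of_hasCompactSupport (HasCompactSupport.of_compactSpace _))]
    simpa using MeasureTheory.norm_integral_le_of_norm_le_const
      (μ := AddCircle.haarAddCircle (T := (1 : ℝ))) (Eventually.of_forall hfg)
  have h3 := hN₀ N hN
  have h4 := dist_triangle4 (cesaroMean (fun n => f (x n)) N) (cesaroMean (fun n => g (x n)) N)
    (∫ t, g t ∂AddCircle.haarAddCircle) (∫ t, f t ∂AddCircle.haarAddCircle)
  linarith

theorem half_sub_norm_coe_unitAddCircle (x : ℝ) :
    1 / 2 - ‖(x : UnitAddCircle)‖ = |Int.fract x - 1 / 2| := by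
  rw [UnitAddCircle.norm_eq, abs_sub_round_eq_min]
  rcases le_total (Int.fract x) (1 / 2) with h | h
  · rw [min_eq_left (by linarith), abs_of_nonpos (by linarith)]
    ring
  · rw [min_eq_right (by linarith), abs_of_nonneg (by linarith)]
    ring

theorem integral_half_sub_norm_unitAddCircle :
    ∫ t : UnitAddCircle, ((1 / 2 - ‖t‖ : ℝ) : ℂ) ∂AddCircle.haarAddCircle = 1 / 4 := by
  have hv : (AddCircle.haarAddCircle : MeasureTheory.Measure UnitAddCircle) =
      MeasureTheory.volume := by
    simp [AddCircle.volume_eq_smul_haarAddCircle]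
  rw [hv, integral_complex_ofReal, ← UnitAddCircle.intervalIntegral_preimage 0, zero_add]
  have hint : ∀ a b : ℝ, IntervalIntegrable (fun x : ℝ => 1 / 2 - ‖(x : UnitAddCircle)‖)
      MeasureTheory.volume a b := fun a b => Continuous.intervalIntegrable (by
        exact continuous_const.sub (continuous_norm.comp (AddCircle.continuous_mk' 1))) a b
  rw [← intervalIntegral.integral_add_adjacent_intervals (hint 0 (1 / 2)) (hint (1 / 2) 1)]
  have h1 : ∫ x in (0 : ℝ)..1 / 2, (1 / 2 - ‖(x : UnitAddCircle)‖) =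
      ∫ x in (0 : ℝ)..1 / 2, (1 / 2 - x) := by
    refine intervalIntegral.integral_congr fun x hx => ?_
    rw [Set.uIcc_of_le (by norm_num)] at hx
    rw [(AddCircle.norm_coe_eq_abs_iff 1 one_ne_zero).2, abs_of_nonneg hx.1]
    rw [abs_of_nonneg hx.1, abs_one]
    exact hx.2
  have h2 : ∫ x in (1 / 2 : ℝ)..1, (1 / 2 - ‖(x : UnitAddCircle)‖) =
      ∫ x in (1 / 2 : ℝ)..1, (x - 1 / 2) := by
    refine intervalIntegral.integral_congr fun x hx => ?_
    rw [Set.uIcc_of_le (by norm_num)] at hx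
    have e : (x : UnitAddCircle) = ((x - 1 : ℝ) : UnitAddCircle) := by
      rw [AddCircle.coe_sub, AddCircle.coe_period, sub_zero]
    have h3 : |x - 1| = 1 - x := by
      rw [abs_of_nonpos (by linarith [hx.2])]
      ring
    rw [e, (AddCircle.norm_coe_eq_abs_iff 1 one_ne_zero).2, h3]
    · ring
    · rw [h3, abs_one]
      linarith [hx.1]
  rw [h1, h2]
  rw [intervalIntegral.integral_sub (by simp) (by simp),
    intervalIntegral.integral_sub (by simp) (by simp)]
  norm_num [integral_id]

theorem tendsto_average_abs_fract_rpow_sub_half {κ : ℝ} (hκ : 0 < κ) (hκn : ∀ j : ℕ, κ ≠ j) :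
    Tendsto (fun N : ℕ => (N : ℝ)⁻¹ * ∑ n ∈ Finset.range N, |Int.fract ((n : ℝ) ^ κ) - 1 / 2|)
      atTop (𝓝 (1 / 4)) := by
  have h := tendsto_cesaroMean_of_fourier (x := fun n : ℕ => (((n : ℝ) ^ κ : ℝ) : UnitAddCircle))
    (fun k hk => by
      refine (tendsto_cesaroMean_unitExp_rpow hκ hκn (α := 2 * π * k)
        (mul_ne_zero two_pi_pos.ne' (by exact_mod_cast hk))).congr fun N => ?_
      simp only [cesaroMean]
      congr 1
      refine Finset.sum_congr rfl fun n _ => ?_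
      rw [fourier_coe_apply, unitExp]
      push_cast
      ring_nf)
    ⟨fun t => ((1 / 2 - ‖t‖ : ℝ) : ℂ),
      Complex.continuous_ofReal.comp (continuous_const.sub continuous_norm)⟩
  simp only [ContinuousMap.coe_mk, integral_half_sub_norm_unitAddCircle,
    half_sub_norm_coe_unitAddCircle] at h
  have h' := (Complex.continuous_re.tendsto _).comp h
  have e : (1 / 4 : ℂ).re = 1 / 4 := by norm_num
  rw [e] at h'
  refine h'.congr fun N => ?_
  simp only [Function.comp_apply, cesaroMean, Complex.real_smul, Complex.re_ofReal_mul,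
    ← Complex.ofReal_sum, Complex.ofReal_re]

theorem norm_unitExp_sub_one_le (t : ℝ) : ‖unitExp t - 1‖ ≤ |t| := by
  have := Real.norm_exp_I_mul_ofReal_sub_one_le (x := t)
  rwa [mul_comm, Real.norm_eq_abs] at this

theorem norm_sum_unitExp_floor_le (s : Finset ℕ) (x : ℕ → ℝ) (hx : ∀ n, 0 ≤ x n) {y : ℝ}
    (hy : |y| ≤ 1 / 2) :
    ‖∑ n ∈ s, unitExp (2 * π * y * ⌊x n⌋₊)‖ ≤
      ‖∑ n ∈ s, unitExp (2 * π * y * x n)‖ + π * ∑ n ∈ s, |Int.fract (x n) - 1 / 2| := by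
  set r : ℕ → ℝ := fun n => Int.fract (x n) - 1 / 2 with hr
  have hterm : ∀ n, unitExp (2 * π * y * ⌊x n⌋₊) =
      unitExp (-(π * y)) * (unitExp (2 * π * y * x n) +
        unitExp (2 * π * y * x n) * (unitExp (-(2 * π * y * r n)) - 1)) := by
    intro n
    have : ((⌊x n⌋₊ : ℕ) : ℝ) = x n - r n - 1 / 2 := by
      rw [natCast_floor_eq_intCast_floor (hx n), ← Int.self_sub_fract (x n)]
      simp only [hr]
      ring
    rw [this, mul_sub_one, add_sub_cancel, ← unitExp_add, ← unitExp_add]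
    ring_nf
  simp only [hterm]
  rw [← Finset.mul_sum, norm_mul, norm_unitExp, one_mul, Finset.sum_add_distrib, Finset.mul_sum]
  refine (norm_add_le _ _).trans ?_
  gcongr
  refine norm_sum_le_of_le _ fun n _ => ?_
  rw [norm_mul, norm_unitExp, one_mul]
  refine (norm_unitExp_sub_one_le _).trans ?_
  rw [abs_neg, abs_mul, abs_mul, abs_of_pos two_pi_pos]
  calc 2 * π * |y| * |r n| ≤ 2 * π * (1 / 2) * |r n| := by gcongr
    _ = π * |r n| := by ring

theorem stmt13 (κ : ℝ) (hκ : 0 < κ) (hκn : ∀ j : ℕ, κ ≠ (j : ℝ)) (ε : ℝ) (hε : 0 < ε) :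
    ∃ H₀ : ℕ, ∀ H ≥ H₀, ∀ y : ℝ, |y| ≤ 1 / 2 →
      ‖∑ ℓ ∈ Finset.Ico ((H + 1) / 2) H,
          Complex.exp (2 * (π : ℂ) * Complex.I * (y : ℂ) * ((psPart κ ℓ : ℝ) : ℂ))‖ ≤
        ‖∑ ℓ ∈ Finset.Ico ((H + 1) / 2) H,
            Complex.exp (2 * (π : ℂ) * Complex.I * (y : ℂ) * (((ℓ : ℝ) ^ κ : ℝ) : ℂ))‖ +
          π * H / 8 + ε * H := by
  set A : ℕ → ℝ := fun N => ∑ n ∈ Finset.range N, |Int.fract ((n : ℝ) ^ κ) - 1 / 2| with hA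
  set δ : ℝ := ε / (2 * π) with hδ
  have hδ0 : 0 < δ := by positivity
  obtain ⟨N₀, hN₀⟩ := Metric.tendsto_atTop.1 (tendsto_average_abs_fract_rpow_sub_half hκ hκn) δ hδ0
  have hAN : ∀ N, N₀ < N → |A N - N / 4| ≤ δ * N := by
    intro N hN
    have hpos : (0 : ℝ) < N := by exact_mod_cast (Nat.zero_le _).trans_lt hN
    have h := (hN₀ N hN.le).le
    rw [Real.dist_eq] at h
    calc |A N - N / 4| = |(N : ℝ)⁻¹ * A N - 1 / 4| * N := by
          rw [← abs_of_pos hpos, ← abs_mul, abs_of_pos hpos]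
          congr 1
          field_simp
      _ ≤ δ * N := by gcongr
  refine ⟨2 * N₀ + 2, fun H hH y hy => ?_⟩
  set m := (H + 1) / 2 with hm
  have hmH : m ≤ H := by omega
  have hm2 : (H : ℝ) ≤ 2 * m := by exact_mod_cast (by omega : H ≤ 2 * m)
  have hsum : ∑ n ∈ Finset.Ico m H, |Int.fract ((n : ℝ) ^ κ) - 1 / 2| ≤ H / 8 + 2 * δ * H := by
    rw [Finset.sum_Ico_eq_sub _ hmH]
    have h1 := (abs_le.1 (hAN H (by omega))).2
    have h2 := (abs_le.1 (hAN m (by omega))).1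
    have h3 : δ * m ≤ δ * H := by gcongr
    linarith
  have hmain := norm_sum_unitExp_floor_le (Finset.Ico m H) (fun n : ℕ => (n : ℝ) ^ κ)
    (fun n => by positivity) hy
  have hexp : ∀ t : ℝ, Complex.exp (2 * (π : ℂ) * Complex.I * (y : ℂ) * (t : ℂ)) =
      unitExp (2 * π * y * t) := fun t => by
    rw [unitExp]
    push_cast
    ring_nf
  simp only [hexp, psPart]
  have h4 := mul_le_mul_of_nonneg_left hsum pi_pos.le
  have h5 : π * (2 * δ * H) = ε * H := by
    rw [hδ]
    field_simp
  linarith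
end

section
/- Let κ > 0 with κ ∉ ℕ and let c > 0. Then for every ε > 0 there exists H₀ such that for all integers H ≥ H₀ and all real y with c·(log H)^{−2κ} ≤ y ≤ 1/2: | Σ_{H/2 ≤ ℓ < H} e^{2πi·y·ℓ^κ} | ≤ εH, where the sum runs over integers ℓ with H/2 ≤ ℓ < H. -/
open Filter Topology Real

/-- The additive character `t ↦ exp (2 π i t)` on the reals. -/
noncomputable def unitPhase (t : ℝ) : ℂ := Complex.exp (Complex.I * ((2 * π * t : ℝ) : ℂ))

theorem norm_unitPhase (t : ℝ) : ‖unitPhase t‖ = 1 := by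
  rw [unitPhase, Complex.norm_exp_I_mul_ofReal]

theorem unitPhase_add (s t : ℝ) : unitPhase (s + t) = unitPhase s * unitPhase t := by
  simp only [unitPhase, ← Complex.exp_add]
  congr 1
  push_cast
  ring

theorem conj_unitPhase (t : ℝ) : (starRingEnd ℂ) (unitPhase t) = unitPhase (-t) := by
  rw [unitPhase, unitPhase, ← Complex.exp_conj]
  congr 1
  rw [map_mul, Complex.conj_I, Complex.conj_ofReal]
  push_cast
  ring

theorem norm_unitPhase_sub_le (s t : ℝ) : ‖unitPhase s - unitPhase t‖ ≤ 2 * π * |s - t| := by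
  have h : unitPhase s - unitPhase t = unitPhase t * (unitPhase (s - t) - 1) := by
    rw [mul_sub, ← unitPhase_add]
    simp
  rw [h, norm_mul, norm_unitPhase, one_mul, unitPhase]
  refine Real.norm_exp_I_mul_ofReal_sub_one_le.trans ?_
  rw [Real.norm_eq_abs, abs_mul, abs_of_pos (by positivity : 0 < 2 * π)]

theorem four_mul_abs_le_norm_unitPhase_sub_one {t : ℝ} (ht : |t| ≤ 1 / 2) :
    4 * |t| ≤ ‖unitPhase t - 1‖ := by
  rw [unitPhase, Complex.norm_exp_I_mul_ofReal_sub_one]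
  have h1 : 2 * π * t / 2 = π * t := by ring
  have h2 : |π * t| = π * |t| := by rw [abs_mul, abs_of_pos pi_pos]
  rw [h1, norm_mul, Real.norm_eq_abs, Real.norm_eq_abs, abs_two]
  have h3 := Real.mul_abs_le_abs_sin (x := π * t) (by rw [h2]; nlinarith [pi_pos])
  rw [h2] at h3
  have h4 : 2 / π * (π * |t|) = 2 * |t| := by field_simp
  linarith

theorem sum_Ico_sub_mul (a w : ℕ → ℂ) {A B : ℕ} (hAB : A ≤ B) :
    ∑ n ∈ Finset.Ico A B, (a (n + 1) - a n) * w n =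
      a B * w B - a A * w A - ∑ n ∈ Finset.Ico A B, a (n + 1) * (w (n + 1) - w n) := by
  induction B, hAB using Nat.le_induction with
  | base => simp
  | succ n hn ih =>
    rw [Finset.sum_Ico_succ_top hn, Finset.sum_Ico_succ_top hn, ih]
    ring

/-- A first derivative test: exponential sums whose phase has small, slowly varying increments
bounded away from zero. -/
theorem norm_sum_unitPhase_le (f : ℕ → ℝ) {A B : ℕ} (hAB : A ≤ B) {δ v : ℝ} (hδ : 0 < δ)
    (hlow : ∀ n, A ≤ n → n ≤ B → δ ≤ |f (n + 1) - f n|)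
    (hup : ∀ n, A ≤ n → n ≤ B → |f (n + 1) - f n| ≤ 1 / 2)
    (hvar : ∀ n, A ≤ n → n < B → |(f (n + 2) - f (n + 1)) - (f (n + 1) - f n)| ≤ v) :
    ‖∑ n ∈ Finset.Ico A B, unitPhase (f n)‖ ≤ 1 / (2 * δ) + ((B - A : ℕ) : ℝ) * (v / δ ^ 2) := by
  set d : ℕ → ℂ := fun n => unitPhase (f (n + 1) - f n) - 1 with hd
  have hdl : ∀ n, A ≤ n → n ≤ B → 4 * δ ≤ ‖d n‖ := fun n h1 h2 =>
    (mul_le_mul_of_nonneg_left (hlow n h1 h2) (by norm_num)).trans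
      (four_mul_abs_le_norm_unitPhase_sub_one (hup n h1 h2))
  have hd0 : ∀ n, A ≤ n → n ≤ B → d n ≠ 0 := fun n h1 h2 => by
    rw [← norm_pos_iff]
    linarith [hdl n h1 h2]
  have hinv : ∀ n, A ≤ n → n ≤ B → ‖(d n)⁻¹‖ ≤ 1 / (4 * δ) := fun n h1 h2 => by
    rw [norm_inv, one_div]
    exact inv_anti₀ (by positivity) (hdl n h1 h2)
  have hsum : ∑ n ∈ Finset.Ico A B, unitPhase (f n) =
      ∑ n ∈ Finset.Ico A B, (unitPhase (f (n + 1)) - unitPhase (f n)) * (d n)⁻¹ := by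
    refine Finset.sum_congr rfl fun n hn => ?_
    rw [Finset.mem_Ico] at hn
    rw [eq_mul_inv_iff_mul_eq₀ (hd0 n hn.1 hn.2.le), hd, mul_sub, ← unitPhase_add]
    simp
  have hdiff : ∀ n ∈ Finset.Ico A B,
      ‖unitPhase (f (n + 1)) * ((d (n + 1))⁻¹ - (d n)⁻¹)‖ ≤ v / δ ^ 2 := fun n hn => by
    rw [Finset.mem_Ico] at hn
    rw [norm_mul, norm_unitPhase, one_mul,
      inv_sub_inv (hd0 _ (by omega) (by omega)) (hd0 _ hn.1 hn.2.le), norm_div, norm_mul]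
    have h1 : ‖d n - d (n + 1)‖ ≤ 2 * π * v := by
      have : d n - d (n + 1) =
          unitPhase (f (n + 1) - f n) - unitPhase (f (n + 2) - f (n + 1)) := by
        simp [hd]
      rw [this]
      refine (norm_unitPhase_sub_le _ _).trans ?_
      rw [abs_sub_comm]
      exact mul_le_mul_of_nonneg_left (hvar n hn.1 hn.2) (by positivity)
    have h2 : 16 * δ ^ 2 ≤ ‖d (n + 1)‖ * ‖d n‖ := by
      have := mul_le_mul (hdl (n + 1) (by omega) (by omega)) (hdl n hn.1 hn.2.le)
        (by positivity) (by positivity)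
      linarith
    have hv : 0 ≤ v := (abs_nonneg _).trans (hvar n hn.1 hn.2)
    rw [div_le_div_iff₀ (by nlinarith [sq_pos_of_pos hδ]) (by positivity)]
    have h3 : ‖d n - d (n + 1)‖ ≤ 16 * v := by nlinarith [pi_lt_four]
    calc ‖d n - d (n + 1)‖ * δ ^ 2 ≤ 16 * v * δ ^ 2 := by gcongr
      _ = v * (16 * δ ^ 2) := by ring
      _ ≤ _ := by gcongr
  rw [hsum, sum_Ico_sub_mul (fun n => unitPhase (f n)) (fun n => (d n)⁻¹) hAB]
  have hend : ∀ n, A ≤ n → n ≤ B → ‖unitPhase (f n) * (d n)⁻¹‖ ≤ 1 / (4 * δ) :=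
    fun n h1 h2 => by rw [norm_mul, norm_unitPhase, one_mul]; exact hinv n h1 h2
  have htail := Finset.sum_le_card_nsmul _ _ _ hdiff
  rw [Nat.card_Ico, nsmul_eq_mul] at htail
  have hhalf : 1 / (2 * δ) = 1 / (4 * δ) + 1 / (4 * δ) := by field_simp; norm_num
  rw [hhalf]
  refine (norm_sub_le _ _).trans (add_le_add ((norm_sub_le _ _).trans
    (add_le_add (hend B hAB le_rfl) (hend A le_rfl hAB))) ((norm_sum_le _ _).trans htail))

theorem norm_sum_Ico_shift_sub_le (b : ℕ → ℂ) (hb : ∀ n, ‖b n‖ ≤ 1) {A B : ℕ} (hAB : A ≤ B)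
    (q : ℕ) :
    ‖∑ n ∈ Finset.Ico A B, b (n + q) - ∑ n ∈ Finset.Ico A B, b n‖ ≤ 2 * q := by
  induction q with
  | zero => simp
  | succ q ih =>
    have h : ∑ n ∈ Finset.Ico A B, b (n + (q + 1)) - ∑ n ∈ Finset.Ico A B, b (n + q) =
        b (B + q) - b (A + q) := by
      rw [← Finset.sum_sub_distrib,
        ← Finset.sum_Ico_sub (fun n => b (n + q)) hAB]
      exact Finset.sum_congr rfl fun n _ => by rw [add_right_comm n 1 q]; rfl
    have h1 : ‖b (B + q) - b (A + q)‖ ≤ 2 := by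
      refine (norm_sub_le _ _).trans ?_
      linarith [hb (B + q), hb (A + q)]
    have h2 := norm_add_le (b (B + q) - b (A + q))
      (∑ n ∈ Finset.Ico A B, b (n + q) - ∑ n ∈ Finset.Ico A B, b n)
    rw [← h, sub_add_sub_cancel, h] at h2
    push_cast
    linarith

/-- Van der Corput's inequality, in a crude form. -/
theorem sq_norm_sum_le_of_correlations (a : ℕ → ℂ) (ha : ∀ n, ‖a n‖ ≤ 1) {A B Q : ℕ}
    (hAB : A ≤ B) {D N : ℝ} (hD : 0 ≤ D) (hN : ((B - A : ℕ) : ℝ) ≤ N)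
    (hcor : ∀ h, 0 < h → h < Q →
      ‖∑ n ∈ Finset.Ico A B, a (n + h) * (starRingEnd ℂ) (a n)‖ ≤ D) :
    (Q * ‖∑ n ∈ Finset.Ico A B, a n‖ - 2 * Q ^ 2) ≤ √(N * (Q * N + Q ^ 2 * (D + 2 * Q))) := by
  have hN0 : 0 ≤ N := (Nat.cast_nonneg _).trans hN
  set T : ℂ := ∑ n ∈ Finset.Ico A B, ∑ q ∈ Finset.range Q, a (n + q) with hT
  have hTS : ‖T - Q * ∑ n ∈ Finset.Ico A B, a n‖ ≤ 2 * Q ^ 2 := by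
    rw [hT, Finset.sum_comm]
    have : ∑ q ∈ Finset.range Q, ∑ n ∈ Finset.Ico A B, a (n + q) -
        Q * ∑ n ∈ Finset.Ico A B, a n =
        ∑ q ∈ Finset.range Q, (∑ n ∈ Finset.Ico A B, a (n + q) - ∑ n ∈ Finset.Ico A B, a n) := by
      rw [Finset.sum_sub_distrib]
      simp
    rw [this]
    have h := Finset.sum_le_card_nsmul (Finset.range Q)
      (fun q => ‖∑ n ∈ Finset.Ico A B, a (n + q) - ∑ n ∈ Finset.Ico A B, a n‖) (2 * Q : ℝ)
      fun q hq => by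
        refine (norm_sum_Ico_shift_sub_le a ha hAB q).trans ?_
        have : (q : ℝ) ≤ Q := by exact_mod_cast (Finset.mem_range.1 hq).le
        linarith
    rw [Finset.card_range, nsmul_eq_mul] at h
    refine (norm_sum_le _ _).trans (h.trans_eq (by ring))
  have hlt : ∀ q r, q < r → r < Q →
      ‖∑ n ∈ Finset.Ico A B, a (n + r) * (starRingEnd ℂ) (a (n + q))‖ ≤ D + 2 * Q := by
    intro q r hqr hr
    have h1 := norm_sum_Ico_shift_sub_le
      (fun n => a (n + (r - q)) * (starRingEnd ℂ) (a n)) (fun n => by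
        rw [norm_mul, RCLike.norm_conj]
        exact mul_le_one₀ (ha _) (norm_nonneg _) (ha _)) hAB q
    have h2 := hcor (r - q) (by omega) (by omega)
    have h3 : ∀ n, n + q + (r - q) = n + r := fun n => by omega
    simp only [h3] at h1
    have h4 : (q : ℝ) ≤ Q := by exact_mod_cast (hqr.trans hr).le
    have h5 := norm_le_norm_add_norm_sub'
      (∑ n ∈ Finset.Ico A B, a (n + r) * (starRingEnd ℂ) (a (n + q)))
      (∑ n ∈ Finset.Ico A B, a (n + (r - q)) * (starRingEnd ℂ) (a n))
    linarith
  have hpair : ∀ q ∈ Finset.range Q, ∀ r ∈ Finset.range Q,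
      ‖∑ n ∈ Finset.Ico A B, a (n + q) * (starRingEnd ℂ) (a (n + r))‖ ≤
        (if q = r then N else 0) + (D + 2 * Q) := by
    intro q hq r hr
    rw [Finset.mem_range] at hq hr
    rcases lt_trichotomy q r with h | h | h
    · rw [if_neg h.ne, zero_add, ← RCLike.norm_conj, map_sum]
      refine le_of_eq_of_le ?_ (hlt q r h hr)
      congr 1
      exact Finset.sum_congr rfl fun n _ => by simp [mul_comm]
    · rw [if_pos h]
      have h1 := Finset.sum_le_card_nsmul (Finset.Ico A B)
        (fun n => ‖a (n + q) * (starRingEnd ℂ) (a (n + r))‖) 1 fun n _ => by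
          rw [norm_mul, RCLike.norm_conj]
          exact mul_le_one₀ (ha _) (norm_nonneg _) (ha _)
      rw [Nat.card_Ico, nsmul_eq_mul, mul_one] at h1
      have h2 : (0 : ℝ) ≤ Q := Nat.cast_nonneg _
      linarith [norm_sum_le (Finset.Ico A B) fun n => a (n + q) * (starRingEnd ℂ) (a (n + r))]
    · rw [if_neg h.ne', zero_add]
      exact hlt r q h hq
  have hsq : ∑ n ∈ Finset.Ico A B, ‖∑ q ∈ Finset.range Q, a (n + q)‖ ^ 2 ≤
      Q * N + Q ^ 2 * (D + 2 * Q) := by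
    have hid : ((∑ n ∈ Finset.Ico A B, ‖∑ q ∈ Finset.range Q, a (n + q)‖ ^ 2 : ℝ) : ℂ) =
        ∑ q ∈ Finset.range Q, ∑ r ∈ Finset.range Q,
          ∑ n ∈ Finset.Ico A B, a (n + q) * (starRingEnd ℂ) (a (n + r)) := by
      push_cast
      simp_rw [← Complex.mul_conj', map_sum, Finset.sum_mul_sum]
      rw [Finset.sum_comm]
      exact Finset.sum_congr rfl fun q _ => Finset.sum_comm
    have h1 : ‖((∑ n ∈ Finset.Ico A B, ‖∑ q ∈ Finset.range Q, a (n + q)‖ ^ 2 : ℝ) : ℂ)‖ =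
        ∑ n ∈ Finset.Ico A B, ‖∑ q ∈ Finset.range Q, a (n + q)‖ ^ 2 := by
      rw [Complex.norm_real, Real.norm_eq_abs, abs_of_nonneg (by positivity)]
    rw [← h1, hid]
    calc _ ≤ ∑ q ∈ Finset.range Q, ∑ r ∈ Finset.range Q,
          ((if q = r then N else 0) + (D + 2 * Q)) :=
        (norm_sum_le _ _).trans (Finset.sum_le_sum fun q hq =>
          (norm_sum_le _ _).trans (Finset.sum_le_sum fun r hr => hpair q hq r hr))
      _ = Q * N + Q ^ 2 * (D + 2 * Q) := by
        have : ∀ q ∈ Finset.range Q, ∑ r ∈ Finset.range Q,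
            ((if q = r then N else 0) + (D + 2 * Q)) = N + Q * (D + 2 * Q) := fun q hq => by
          rw [Finset.sum_add_distrib, Finset.sum_ite_eq, if_pos hq, Finset.sum_const, Finset.card_range,
            nsmul_eq_mul]
        rw [Finset.sum_congr rfl this]
        simp
        ring
  have hTb : ‖T‖ ≤ √(N * (Q * N + Q ^ 2 * (D + 2 * Q))) := by
    refine Real.le_sqrt_of_sq_le ?_
    have h1 := sq_sum_le_card_mul_sum_sq (s := Finset.Ico A B)
      (f := fun n => ‖∑ q ∈ Finset.range Q, a (n + q)‖)
    rw [Nat.card_Ico] at h1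
    have h2 : ‖T‖ ^ 2 ≤ (∑ n ∈ Finset.Ico A B, ‖∑ q ∈ Finset.range Q, a (n + q)‖) ^ 2 := by
      gcongr
      exact norm_sum_le _ _
    exact h2.trans (h1.trans (mul_le_mul hN hsq (by positivity) hN0))
  have h6 := norm_sub_norm_le (Q * ∑ n ∈ Finset.Ico A B, a n) T
  rw [norm_sub_rev, norm_mul, Complex.norm_natCast] at h6
  linarith

/-- `G j` is the `j`-th derivative of `G 0`, and has exact order of magnitude `x ^ (α - j)`. -/
structure PowerLike (α : ℝ) (G : ℕ → ℝ → ℝ) : Prop where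
  hasDerivAt : ∀ j x, 0 < x → HasDerivAt (G j) (G (j + 1) x) x
  bounds : ∀ j : ℕ, ∃ m M : ℝ, 0 < m ∧ 0 < M ∧
    ∀ x, 1 ≤ x → m * x ^ (α - j) ≤ |G j x| ∧ |G j x| ≤ M * x ^ (α - j)

theorem powerLike_rpow {κ : ℝ} (hκ : ∀ j : ℕ, κ ≠ j) :
    PowerLike κ fun j x => (∏ i ∈ Finset.range j, (κ - i)) * x ^ (κ - j) where
  hasDerivAt j x hx := by
    have h := (Real.hasDerivAt_rpow_const (p := κ - j) (Or.inl hx.ne')).const_mul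
      (∏ i ∈ Finset.range j, (κ - i))
    refine h.congr_deriv ?_
    rw [Finset.prod_range_succ]
    push_cast
    rw [sub_add_eq_sub_sub]
    ring
  bounds j := by
    have h : 0 < |∏ i ∈ Finset.range j, (κ - i)| :=
      abs_pos.2 (Finset.prod_ne_zero_iff.2 fun i _ => sub_ne_zero.2 (hκ i))
    refine ⟨_, _, h, h, fun x hx => ?_⟩
    rw [abs_mul, abs_of_pos (Real.rpow_pos_of_pos (by linarith : 0 < x) (κ - j))]
    exact ⟨le_rfl, le_rfl⟩

theorem rpow_comparable {K : ℝ} (hK : 1 ≤ K) (β : ℝ) {x t : ℝ} (hx : 0 < x) (hxt : x ≤ t)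
    (htK : t ≤ K * x) : K ^ (-|β|) * x ^ β ≤ t ^ β ∧ t ^ β ≤ K ^ |β| * x ^ β := by
  have hK0 : 0 < K := by linarith
  have ht : 0 < t := hx.trans_le hxt
  have hxp := Real.rpow_pos_of_pos hx β
  have h1 : 1 ≤ t / x := (one_le_div hx).2 hxt
  have h2 : t / x ≤ K := (div_le_iff₀ hx).2 htK
  have h3 : t ^ β = (t / x) ^ β * x ^ β := by
    rw [Real.div_rpow ht.le hx.le, div_mul_cancel₀ _ hxp.ne']
  rw [h3]
  have h4 : (t / x) ^ |β| ≤ K ^ |β| := Real.rpow_le_rpow (by linarith) h2 (abs_nonneg _)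
  constructor
  · refine mul_le_mul_of_nonneg_right ?_ hxp.le
    refine le_trans ?_ (Real.rpow_le_rpow_of_exponent_le h1 (neg_abs_le β))
    rw [Real.rpow_neg hK0.le, Real.rpow_neg (by linarith)]
    exact inv_anti₀ (Real.rpow_pos_of_pos (by linarith) _) h4
  · refine mul_le_mul_of_nonneg_right ?_ hxp.le
    exact (Real.rpow_le_rpow_of_exponent_le h1 (le_abs_self β)).trans h4

theorem PowerLike.forwardDiff {α : ℝ} {G : ℕ → ℝ → ℝ} (hG : PowerLike α G) {h : ℝ} (hh : 0 < h) :
    PowerLike (α - 1) fun j x => G j (x + h) - G j x where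
  hasDerivAt j x hx :=
    (HasDerivAt.comp_add_const x h (hG.hasDerivAt j (x + h) (by linarith))).sub
      (hG.hasDerivAt j x hx)
  bounds j := by
    obtain ⟨m, M, hm, hM, hb⟩ := hG.bounds (j + 1)
    have hK : 0 < 1 + h := by linarith
    refine ⟨h * (m * (1 + h) ^ (-|α - 1 - j|)), h * (M * (1 + h) ^ |α - 1 - j|),
      by positivity, by positivity, fun x hx => ?_⟩
    obtain ⟨t, ht, hmv⟩ := exists_hasDerivAt_eq_slope (G j) (G (j + 1))
      (by linarith : x < x + h)
      (fun z hz => (hG.hasDerivAt j z (by linarith [hz.1])).continuousAt.continuousWithinAt)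
      (fun z hz => hG.hasDerivAt j z (by linarith [hz.1]))
    have hd : G j (x + h) - G j x = h * G (j + 1) t := by
      rw [hmv, add_sub_cancel_left, mul_div_cancel₀ _ hh.ne']
    have hbt := hb t (by linarith [ht.1])
    have hexp : α - ((j + 1 : ℕ) : ℝ) = α - 1 - j := by push_cast; ring
    rw [hexp] at hbt
    have hc := rpow_comparable (K := 1 + h) (by linarith) (α - 1 - j) (by linarith : 0 < x)
      ht.1.le (by nlinarith [ht.2])
    simp only [hd, abs_mul, abs_of_pos hh, mul_assoc]
    exact ⟨mul_le_mul_of_nonneg_left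
        ((mul_le_mul_of_nonneg_left hc.1 hm.le).trans hbt.1) hh.le,
      mul_le_mul_of_nonneg_left
        (hbt.2.trans (mul_le_mul_of_nonneg_left hc.2 hM.le)) hh.le⟩

/-- Cancellation in `∑ e(y G₀(n))` over a dyadic range when `G₀` grows like a power with exponent
in `(0, 1)`. -/
theorem PowerLike.eventually_sum_le_of_lt_one {Y : ℕ → ℝ} (hY0 : ∀ᶠ H in atTop, 0 < Y H)
    (hY : ∀ s : ℝ, 0 < s → Tendsto (fun H : ℕ => Y H * (H : ℝ) ^ s) atTop atTop)
    {α : ℝ} (hα0 : 0 < α) (hα1 : α < 1) {G : ℕ → ℝ → ℝ} (hG : PowerLike α G)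
    {ε : ℝ} (hε : 0 < ε) :
    ∀ᶠ H : ℕ in atTop, ∀ y, Y H ≤ y → y ≤ 1 / 2 →
      ‖∑ n ∈ Finset.Ico ((H + 1) / 2) H, unitPhase (y * G 0 n)‖ ≤ ε * H := by
  have hG1 := hG.forwardDiff one_pos
  obtain ⟨m, M, hm, hM, hb⟩ := hG1.bounds 0
  obtain ⟨_, M', _, hM', hb'⟩ := (hG1.forwardDiff one_pos).bounds 0
  simp only [Nat.cast_zero, sub_zero] at hb hb'
  set C : ℝ := M' * (1 / 2) ^ (α - 1 - 1) with hC
  have hC0 : 0 < C := by positivity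
  have hsmall : Tendsto (fun H : ℕ => M * ((H : ℝ) * (1 / 2)) ^ (α - 1)) atTop (𝓝 (M * 0)) := by
    refine Tendsto.const_mul M ?_
    have h1 : Tendsto (fun H : ℕ => (H : ℝ) * (1 / 2)) atTop atTop :=
      tendsto_natCast_atTop_atTop.atTop_mul_const (by norm_num)
    have h2 := (tendsto_rpow_neg_atTop (by linarith : 0 < 1 - α)).comp h1
    simpa [Function.comp_def] using h2
  rw [mul_zero] at hsmall
  filter_upwards [hY0, (hY α hα0).eventually_ge_atTop ((1 / (2 * m) + C / m ^ 2) / ε),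
    hsmall.eventually_le_const one_pos, eventually_ge_atTop 2] with H hYH hbig hsm hH y hy hy2
  have hy0 : 0 < y := hYH.trans_le hy
  have hHr : (2 : ℝ) ≤ H := by exact_mod_cast hH
  have hHpos : (0 : ℝ) < H := by linarith
  set P : ℝ := (H : ℝ) ^ (α - 1) with hP
  have hP0 : 0 < P := Real.rpow_pos_of_pos hHpos _
  have hHα : (H : ℝ) ^ α = H * P := by
    rw [hP, ← Real.rpow_one_add' hHpos.le (by linarith)]
    congr 1
    ring
  have hlowbd : ∀ n : ℕ, (H + 1) / 2 ≤ n → (H : ℝ) * (1 / 2) ≤ n := fun n hn => by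
    have : H ≤ 2 * n := by omega
    have : (H : ℝ) ≤ 2 * n := by exact_mod_cast this
    linarith
  have key := norm_sum_unitPhase_le (fun n : ℕ => y * G 0 n) (A := (H + 1) / 2) (B := H)
    (by omega) (δ := y * (m * P)) (v := y * (C * (P / H))) (by positivity)
    (fun n hn1 hn2 => by
      have h1 := hlowbd n hn1
      have h2 : (n : ℝ) ≤ H := by exact_mod_cast hn2
      have h3 := (hb n (by linarith)).1
      push_cast
      rw [← mul_sub, abs_mul, abs_of_pos hy0]
      refine mul_le_mul_of_nonneg_left (le_trans ?_ h3) hy0.le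
      exact mul_le_mul_of_nonneg_left
        (Real.rpow_le_rpow_of_nonpos (by linarith) h2 (by linarith)) hm.le)
    (fun n hn1 hn2 => by
      have h1 := hlowbd n hn1
      have h3 := (hb n (by linarith)).2
      push_cast
      rw [← mul_sub, abs_mul, abs_of_pos hy0]
      have h4 : (n : ℝ) ^ (α - 1) ≤ ((H : ℝ) * (1 / 2)) ^ (α - 1) :=
        Real.rpow_le_rpow_of_nonpos (by linarith) h1 (by linarith)
      have h5 : |G 0 ((n : ℝ) + 1) - G 0 n| ≤ 1 :=
        h3.trans ((mul_le_mul_of_nonneg_left h4 hM.le).trans hsm)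
      nlinarith [abs_nonneg (G 0 ((n : ℝ) + 1) - G 0 n)])
    (fun n hn1 hn2 => by
      have h1 := hlowbd n hn1
      have h3 := (hb' n (by linarith)).2
      have h4 : (n : ℝ) ^ (α - 1 - 1) ≤ ((H : ℝ) * (1 / 2)) ^ (α - 1 - 1) :=
        Real.rpow_le_rpow_of_nonpos (by linarith) h1 (by linarith)
      rw [Real.mul_rpow hHpos.le (by norm_num), Real.rpow_sub_one hHpos.ne' (α - 1)] at h4
      push_cast
      rw [← mul_sub, ← mul_sub, ← mul_sub, abs_mul, abs_of_pos hy0]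
      refine mul_le_mul_of_nonneg_left ?_ hy0.le
      have h5 : (n : ℝ) + 2 = n + 1 + 1 := by ring
      rw [h5]
      refine h3.trans ((mul_le_mul_of_nonneg_left h4 hM'.le).trans_eq ?_)
      rw [hC, hP]
      ring)
  refine key.trans ?_
  have hcard : ((H - (H + 1) / 2 : ℕ) : ℝ) ≤ H := by exact_mod_cast Nat.sub_le _ _
  have hyP : (1 / (2 * m) + C / m ^ 2) ≤ y * P * (ε * H) := by
    rw [div_le_iff₀ hε, hHα] at hbig
    refine hbig.trans ?_
    have : Y H * (H * P) * ε ≤ y * (H * P) * ε := by gcongr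
    linarith
  calc _ ≤ 1 / (2 * (y * (m * P))) + (H : ℝ) * (y * (C * (P / H)) / (y * (m * P)) ^ 2) := by
        gcongr
    _ = (1 / (2 * m) + C / m ^ 2) / (y * P) := by
        field_simp
    _ ≤ ε * H := by
        rw [div_le_iff₀ (by positivity)]
        linarith

/-- Cancellation in `∑ e(y G₀(n))` over a dyadic range when `G₀` grows like a power with positive
nonintegral exponent. -/
theorem PowerLike.eventually_sum_le {Y : ℕ → ℝ} (hY0 : ∀ᶠ H in atTop, 0 < Y H)
    (hY : ∀ s : ℝ, 0 < s → Tendsto (fun H : ℕ => Y H * (H : ℝ) ^ s) atTop atTop) (k : ℕ) :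
    ∀ {α : ℝ} {G : ℕ → ℝ → ℝ} {ε : ℝ}, k < α → α < k + 1 → PowerLike α G → 0 < ε →
    ∀ᶠ H : ℕ in atTop, ∀ y, Y H ≤ y → y ≤ 1 / 2 →
      ‖∑ n ∈ Finset.Ico ((H + 1) / 2) H, unitPhase (y * G 0 n)‖ ≤ ε * H := by
  induction k with
  | zero =>
    intro α G ε h0 h1 hG hε
    exact hG.eventually_sum_le_of_lt_one hY0 hY (by simpa using h0) (by simpa using h1) hε
  | succ k ih =>
    intro α G ε h0 h1 hG hε
    push_cast at h0 h1
    obtain ⟨Q, hQ⟩ := exists_nat_gt (max 1 (16 / ε ^ 2))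
    have hQ1 : (1 : ℝ) < Q := (le_max_left _ _).trans_lt hQ
    have hQ2 : 16 / ε ^ 2 < Q := (le_max_right _ _).trans_lt hQ
    have hcor : ∀ᶠ H : ℕ in atTop, ∀ h ∈ Finset.Ioo 0 Q, ∀ y, Y H ≤ y → y ≤ 1 / 2 →
        ‖∑ n ∈ Finset.Ico ((H + 1) / 2) H,
          unitPhase (y * (G 0 (n + (h : ℝ)) - G 0 n))‖ ≤ ε ^ 2 / 16 * H := by
      rw [Filter.eventually_all_finset]
      intro h hh
      have hh0 : (0 : ℝ) < h := by exact_mod_cast (Finset.mem_Ioo.1 hh).1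
      have hε' : 0 < ε ^ 2 / 16 := by positivity
      have hα0 : (k : ℝ) < α - 1 := by linarith
      have hα1 : α - 1 < k + 1 := by linarith
      have hdiff := ih hα0 hα1 (hG.forwardDiff hh0) hε'
      exact hdiff
    have hlarge : ∀ᶠ H : ℕ in atTop, (32 * Q / ε ^ 2 + 4 * Q / ε : ℝ) ≤ H :=
      tendsto_natCast_atTop_atTop.eventually_ge_atTop _
    filter_upwards [hcor, hlarge, eventually_ge_atTop 2] with H hcH hlH hH y hy hy2
    have hA : (H + 1) / 2 ≤ H := by omega
    have hHpos : (0 : ℝ) < H := by exact_mod_cast (by omega : 0 < H)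
    have hvdc := sq_norm_sum_le_of_correlations (fun n : ℕ => unitPhase (y * G 0 n))
      (fun n => (norm_unitPhase _).le) (Q := Q) hA (D := ε ^ 2 / 16 * H) (N := H)
      (by positivity) (by exact_mod_cast Nat.sub_le _ _)
      (fun h hh0 hhQ => by
        have := hcH h (Finset.mem_Ioo.2 ⟨hh0, hhQ⟩) y hy hy2
        simp only [conj_unitPhase, ← unitPhase_add, Nat.cast_add]
        simpa only [sub_eq_add_neg, mul_add, mul_neg] using this)
    have hsqrt : √((H : ℝ) * (Q * H + Q ^ 2 * (ε ^ 2 / 16 * H + 2 * Q))) ≤ Q * (ε / 2 * H) := by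
      refine Real.sqrt_le_iff.2 ⟨by positivity, ?_⟩
      have e1 : 16 ≤ Q * ε ^ 2 := ((div_lt_iff₀ (by positivity)).1 hQ2).le
      have e2 : 32 * Q ≤ H * ε ^ 2 := by
        have : 32 * Q / ε ^ 2 ≤ (H : ℝ) := le_trans (by simp; positivity) hlH
        exact (div_le_iff₀ (by positivity)).1 this
      have f1 : (H : ℝ) * (Q * H) * 16 ≤ H * (Q * H) * (Q * ε ^ 2) := by gcongr
      have f2 : (H : ℝ) * Q ^ 2 * (32 * Q) ≤ H * Q ^ 2 * (H * ε ^ 2) := by gcongr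
      have f3 : 0 ≤ (H : ℝ) * Q ^ 2 * (H * ε ^ 2) := by positivity
      linarith
    have hQH : 4 * Q ≤ H * ε := by
      have : 4 * Q / ε ≤ (H : ℝ) := le_trans (by simp; positivity) hlH
      exact (div_le_iff₀ hε).1 this
    have hfin : (Q : ℝ) * ‖∑ n ∈ Finset.Ico ((H + 1) / 2) H, unitPhase (y * G 0 n)‖ ≤
        Q * (ε * H) := by
      have : (Q : ℝ) * (4 * Q) ≤ Q * (H * ε) := by gcongr
      linarith
    exact le_of_mul_le_mul_left hfin (by linarith)

theorem tendsto_const_mul_log_rpow_mul_rpow_atTop {c : ℝ} (hc : 0 < c) (r : ℝ) {s : ℝ}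
    (hs : 0 < s) :
    Tendsto (fun H : ℕ => c * Real.log H ^ (-r) * (H : ℝ) ^ s) atTop atTop := by
  have h0 := (isLittleO_log_rpow_rpow_atTop r hs).tendsto_div_nhds_zero
  have h1 : Tendsto (fun x : ℝ => Real.log x ^ r / x ^ s) atTop (𝓝[>] 0) := by
    refine tendsto_nhdsWithin_iff.2 ⟨h0, ?_⟩
    filter_upwards [eventually_gt_atTop 1] with x hx
    have := Real.log_pos hx
    have : 0 < x := by linarith
    simp only [Set.mem_Ioi]
    positivity
  have h2 := (h1.inv_tendsto_nhdsGT_zero.const_mul_atTop hc).comp tendsto_natCast_atTop_atTop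
  refine h2.congr' ?_
  filter_upwards [eventually_gt_atTop 1] with H hH
  have hl : 0 < Real.log H := Real.log_pos (by exact_mod_cast hH)
  simp only [Function.comp_apply, Pi.inv_apply]
  rw [Real.rpow_neg hl.le, inv_div, mul_assoc]
  congr 1
  field_simp

theorem stmt14 (κ : ℝ) (hκ : 0 < κ) (hκn : ∀ j : ℕ, κ ≠ (j : ℝ)) (c : ℝ) (hc : 0 < c)
    (ε : ℝ) (hε : 0 < ε) :
    ∃ H₀ : ℕ, ∀ H ≥ H₀, ∀ y : ℝ,
      c * (Real.log H) ^ (-(2 * κ)) ≤ y → y ≤ 1 / 2 →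
      ‖∑ ℓ ∈ Finset.Ico ((H + 1) / 2) H,
          Complex.exp (2 * (π : ℂ) * Complex.I * (y : ℂ) * (((ℓ : ℝ) ^ κ : ℝ) : ℂ))‖ ≤ ε * H := by
  have hY0 : ∀ᶠ H : ℕ in atTop, 0 < c * Real.log H ^ (-(2 * κ)) := by
    filter_upwards [eventually_gt_atTop 1] with H hH
    have hl : 0 < Real.log H := Real.log_pos (by exact_mod_cast hH)
    positivity
  have hfloor : (⌊κ⌋₊ : ℝ) < κ := (Nat.floor_le hκ.le).lt_of_ne (hκn _).symm
  obtain ⟨H₀, h⟩ := eventually_atTop.1 (PowerLike.eventually_sum_le hY0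
    (fun s hs => tendsto_const_mul_log_rpow_mul_rpow_atTop hc (2 * κ) hs) ⌊κ⌋₊ hfloor
    (Nat.lt_floor_add_one κ) (powerLike_rpow hκn) hε)
  refine ⟨H₀, fun H hH y hy hy2 => le_of_eq_of_le ?_ (h H hH y hy hy2)⟩
  congr 1
  refine Finset.sum_congr rfl fun n _ => ?_
  rw [unitPhase]
  congr 1
  simp only [Finset.range_zero, Finset.prod_empty, one_mul, Nat.cast_zero, sub_zero]
  push_cast
  ring
end
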